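/- Let N ≥ 1 be an integer, m > 1 and C ≥ 1 real numbers, and 0 < R < R₀ real numbers with R₀ − R ≤ 1. Then there exists a constant C' > 0, depending only on N, m, C, R and R₀, with the following property. Let x₀ ∈ ℝ^N and let S : B_{R₀}(x₀) → ℝ be a measurable nonnegative function with ‖S‖_{L^p(B_{R₀}(x₀))} < ∞ for every p ∈ [1, ∞), and suppose that for every real q ≥ 2 and all radii r₁, r₂ with R ≤ r₁ < r₂ ≤ R₀ one has ‖S‖_{L^{qm/(m−1)}(B_{r₁}(x₀))} ≤ (C·q·(1 + (r₂ − r₁)^{−2}))^{1/q} · ‖S‖_{L^{q+1/2}(B_{r₂}(x₀))}^{(q+1/2)/q}. Then the essential supremum of S over B_R(x₀) satisfies ess sup_{B_R(x₀)} S ≤ C' · ‖S‖_{L^{q₁+1/2}(B_{R₀}(x₀))}^{(m+1)/2}, where q₁ = m/(m−1) + (m−1)/2. -/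

import Mathlib

open MeasureTheory Metric

/-- If `∫ S^(c_j + h) ≤ M^(c_j)` with `c_j → ∞`, then `S ≤ M` a.e. -/
lemma moser_ae_le {α : Type*} [MeasurableSpace α] (μ : Measure α) [IsFiniteMeasure μ]
    (S : α → ℝ) (hS0 : ∀ x, 0 ≤ S x) (M h : ℝ) (hM : 0 ≤ M) (hh : 0 ≤ h)
    (c : ℕ → ℝ) (hc0 : ∀ j, 0 ≤ c j) (hc : Filter.Tendsto c Filter.atTop Filter.atTop)
    (hint : ∀ j, Integrable (fun x => S x ^ (c j + h)) μ)
    (hle : ∀ j, ∫ x, S x ^ (c j + h) ∂μ ≤ M ^ (c j)) :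
    ∀ᵐ x ∂μ, S x ≤ M := by
  have key : ∀ l : ℝ, M < l → μ {x | l ≤ S x} = 0 := by
    intro l hl
    have hl0 : 0 < l := hM.trans_lt hl
    have hb : ∀ j, l ^ h * μ.real {x | l ≤ S x} ≤ (M / l) ^ (c j) := by
      intro j
      have h1 := mul_meas_ge_le_integral_of_nonneg (μ := μ) (f := fun x => S x ^ (c j + h))
        (Filter.Eventually.of_forall fun x => Real.rpow_nonneg (hS0 x) _) (hint j) (l ^ (c j + h))
      have h2 : μ.real {x | l ≤ S x} ≤ μ.real {x | l ^ (c j + h) ≤ S x ^ (c j + h)} := by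
        exact measureReal_mono (fun x hx =>
          Real.rpow_le_rpow hl0.le hx (add_nonneg (hc0 j) hh))
      have h3 : l ^ (c j + h) * μ.real {x | l ≤ S x} ≤ M ^ (c j) :=
        (mul_le_mul_of_nonneg_left h2 (by positivity)).trans (h1.trans (hle j))
      rw [Real.div_rpow hM hl0.le, le_div_iff₀ (by positivity)]
      rw [Real.rpow_add hl0] at h3
      linarith
    have ht : Filter.Tendsto (fun j => (M / l) ^ (c j)) Filter.atTop (nhds 0) := by
      refine (tendsto_rpow_atTop_of_base_lt_one (M / l) ?_ ?_).comp hc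
      · have : 0 ≤ M / l := by positivity
        linarith
      · rw [div_lt_one hl0]; exact hl
    have h4 : l ^ h * μ.real {x | l ≤ S x} ≤ 0 := ge_of_tendsto' ht hb
    have h5 : μ.real {x | l ≤ S x} ≤ 0 := by
      have : 0 < l ^ h := by positivity
      by_contra hcon
      push Not at hcon
      have := mul_pos this hcon
      linarith
    have h6 : μ.real {x | l ≤ S x} = 0 := le_antisymm h5 measureReal_nonneg
    exact (measureReal_eq_zero_iff).1 h6
  have hn : ∀ᵐ x ∂μ, ∀ n : ℕ, S x < M + 1 / ((n : ℝ) + 1) := by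
    rw [ae_all_iff]
    intro n
    have := key (M + 1 / ((n : ℝ) + 1)) (by have : (0:ℝ) < 1 / ((n : ℝ) + 1) := by positivity
                                            linarith)
    rw [ae_iff]
    simpa using this
  filter_upwards [hn] with x hx
  refine ge_of_tendsto' (x := Filter.atTop) (f := fun n : ℕ => M + 1 / ((n : ℝ) + 1)) ?_
    (fun n => (hx n).le)
  simpa using (tendsto_const_nhds (x := M)).add (tendsto_one_div_add_atTop_nhds_zero_nat (𝕜 := ℝ))

/-- One step of the iteration, in terms of integrals. -/
lemma moser_step (m q A I I' c : ℝ) (hm : 1 < m) (hq : 0 < q) (hA : 0 ≤ A) (hI : 0 ≤ I)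
    (hI' : 0 ≤ I')
    (h : I' ^ ((m - 1) / (q * m)) ≤ A ^ (1 / q) * ((I ^ (1 / (q + 1 / 2))) ^ ((q + 1 / 2) / q)))
    (hc : 0 ≤ c) :
    I' ^ (c * ((m - 1) / m)) ≤ A ^ c * I ^ c := by
  have e1 : (I ^ (1 / (q + 1 / 2))) ^ ((q + 1 / 2) / q) = I ^ (1 / q) := by
    rw [← Real.rpow_mul hI]; congr 1; field_simp
  rw [e1, ← Real.mul_rpow hA hI] at h
  have h2 := Real.rpow_le_rpow (by positivity) h (show 0 ≤ q * c by positivity)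
  rw [← Real.rpow_mul hI', ← Real.rpow_mul (by positivity)] at h2
  rw [← Real.mul_rpow hA hI]
  convert h2 using 2
  · field_simp
  · field_simp

lemma moser_summable (x a b : ℝ) (hx0 : 0 ≤ x) (hx1 : x < 1) :
    Summable (fun j : ℕ => x ^ (j + 1) * (a + ((j : ℝ) + 1) * b)) := by
  have hn : ‖x‖ < 1 := by rwa [Real.norm_of_nonneg hx0]
  have h1 := summable_geometric_of_lt_one hx0 hx1
  have h2 := summable_pow_mul_geometric_of_norm_lt_one 1 hn
  have := (h1.mul_left (x * (a + b))).add (h2.mul_left (x * b))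
  refine this.congr ?_
  intro j
  simp only [pow_succ, pow_zero]
  ring

/-- **Abstract Moser iteration step**: let `m > 1`, `C ≥ 1`, `0 < R < R₀` with `R₀ − R ≤ 1`.
There is a constant `C' > 0`, depending only on `N, m, C, R, R₀`, such that any measurable
nonnegative `S` on the ball `B_{R₀}(x₀) ⊂ ℝᴺ`, with finite `L^p` norm for all `p ∈ [1, ∞)`,
satisfying the reverse-Hölder inequalities
`‖S‖_{L^{qm/(m−1)}(B_{r₁})} ≤ (C q (1 + (r₂−r₁)^{−2}))^{1/q} ‖S‖_{L^{q+1/2}(B_{r₂})}^{(q+1/2)/q}`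
for all `q ≥ 2` and `R ≤ r₁ < r₂ ≤ R₀`, obeys
`ess sup_{B_R} S ≤ C' ‖S‖_{L^{q₁+1/2}(B_{R₀})}^{(m+1)/2}` where `q₁ = m/(m−1) + (m−1)/2`.
Here `‖S‖_{L^p(E)} = (∫_E S^p)^{1/p}` with respect to Lebesgue measure. -/
theorem moser_iteration (N : ℕ) (hN : 1 ≤ N) (m C R R₀ : ℝ)
    (hm : 1 < m) (hC : 1 ≤ C) (hR : 0 < R) (hRR₀ : R < R₀) (hR₀R : R₀ - R ≤ 1) :
    ∃ C' : ℝ, 0 < C' ∧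
      ∀ (x₀ : EuclideanSpace ℝ (Fin N)) (S : EuclideanSpace ℝ (Fin N) → ℝ),
        Measurable S → (∀ x, 0 ≤ S x) →
        (∀ p : ℝ, 1 ≤ p → IntegrableOn (fun x => S x ^ p) (ball x₀ R₀) volume) →
        (∀ q : ℝ, 2 ≤ q → ∀ r₁ r₂ : ℝ, R ≤ r₁ → r₁ < r₂ → r₂ ≤ R₀ →
          (∫ x in ball x₀ r₁, S x ^ (q * m / (m - 1))) ^ ((m - 1) / (q * m))
            ≤ (C * q * (1 + ((r₂ - r₁) ^ 2)⁻¹)) ^ (1 / q) *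
              ((∫ x in ball x₀ r₂, S x ^ (q + 1 / 2)) ^ (1 / (q + 1 / 2)))
                ^ ((q + 1 / 2) / q)) →
        essSup S (volume.restrict (ball x₀ R))
          ≤ C' * ((∫ x in ball x₀ R₀,
              S x ^ (m / (m - 1) + (m - 1) / 2 + 1 / 2))
                ^ (1 / (m / (m - 1) + (m - 1) / 2 + 1 / 2))) ^ ((m + 1) / 2) := by
  have ht : 0 < m - 1 := by linarith
  have hm0 : 0 < m := by linarith
  set χ : ℝ := m / (m - 1) with hχ
  have hχ1 : 1 < χ := by rw [hχ, one_lt_div ht]; linarith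
  have hχ0 : 0 < χ := by linarith
  set d : ℝ := R₀ - R with hd
  have hd0 : 0 < d := by linarith
  obtain ⟨K, hK⟩ : ∃ K : ℝ, K = C * (1 + m / 2) * (2 / d ^ 2) := ⟨_, rfl⟩
  have hK0 : 0 < K := by rw [hK]; positivity
  have hd2 : d ^ 2 ≤ 1 := by nlinarith
  have hK1 : 1 ≤ K := by
    have h1 : 1 ≤ 2 / d ^ 2 := by rw [le_div_iff₀ (by positivity)]; linarith
    have h2 : 1 ≤ C * (1 + m / 2) := by nlinarith
    rw [hK]; nlinarith
  obtain ⟨a, ha⟩ : ∃ a : ℕ → ℝ, a = fun j : ℕ =>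
    (χ⁻¹) ^ (j + 1) * (Real.log K + ((j : ℝ) + 1) * Real.log (4 * χ)) := ⟨_, rfl⟩
  have hasum : Summable a := by
    rw [ha]
    exact moser_summable _ _ _ (by positivity) (inv_lt_one_of_one_lt₀ hχ1)
  have ha0 : ∀ j, 0 ≤ a j := by
    intro j
    have h1 := Real.log_nonneg hK1
    have h2 : 0 ≤ Real.log (4 * χ) := Real.log_nonneg (by linarith)
    rw [ha]; positivity
  refine ⟨Real.exp (∑' j, a j), Real.exp_pos _, ?_⟩
  intro x₀ S hS hS0 hint hq
  -- the exponents and radii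
  obtain ⟨p, hp⟩ : ∃ p : ℕ → ℝ, p = fun j => χ ^ (j + 1) + m / 2 := ⟨_, rfl⟩
  obtain ⟨r, hr⟩ : ∃ r : ℕ → ℝ, r = fun j => R + d / 2 ^ j := ⟨_, rfl⟩
  obtain ⟨I, hI⟩ : ∃ I : ℕ → ℝ, I = fun j => ∫ x in ball x₀ (r j), S x ^ (p j) := ⟨_, rfl⟩
  have hI0 : ∀ j, 0 ≤ I j := by
    intro j; rw [hI]
    exact integral_nonneg fun x => Real.rpow_nonneg (hS0 x) _
  have hχpow : ∀ j : ℕ, χ ≤ χ ^ (j + 1) := fun j => le_self_pow₀ hχ1.le (by omega)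
  have hrR : ∀ j, R ≤ r j := by
    intro j
    have : 0 < d / 2 ^ j := by positivity
    rw [hr]; simp only; linarith
  have hrR₀ : ∀ j, r j ≤ R₀ := by
    intro j
    have : d / 2 ^ j ≤ d := div_le_self hd0.le (one_le_pow₀ (by norm_num))
    rw [hr]; simp only; linarith
  have hp1 : ∀ j, 1 ≤ p j := by
    intro j
    have := hχpow j
    rw [hp]; simp only; linarith
  have step : ∀ j, I (j + 1) ^ ((χ⁻¹) ^ (j + 2)) ≤ Real.exp (a j) * I j ^ ((χ⁻¹) ^ (j + 1)) := by
    intro j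
    obtain ⟨q, hqdef⟩ : ∃ q : ℝ, q = χ ^ (j + 1) + (m - 1) / 2 := ⟨_, rfl⟩
    have hq2 : 2 ≤ q := by
      have h1 := hχpow j
      have h2 : 2 ≤ χ + (m - 1) / 2 := by
        have h3 : χ * (m - 1) = m := by rw [hχ]; field_simp
        by_contra hcon
        push Not at hcon
        nlinarith [sq_nonneg (m - 2)]
      linarith
    have hqp : q + 1 / 2 = p j := by rw [hqdef, hp]; simp only; ring
    have hqp' : q * m / (m - 1) = p (j + 1) := by
      have e : q * m / (m - 1) = q * χ := by rw [hχ]; ring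
      have h3 : χ * (m - 1) = m := by rw [hχ]; field_simp
      rw [e, hqdef, hp]; simp only
      rw [pow_succ χ (j + 1)]
      linear_combination (1 / 2) * h3
    have hrr : r j - r (j + 1) = d / 2 ^ (j + 1) := by
      rw [hr]; simp only; rw [pow_succ]; field_simp; ring
    have hδ : 0 < d / 2 ^ (j + 1) := by positivity
    have h := hq q hq2 (r (j + 1)) (r j) (hrR _) (by linarith) (hrR₀ _)
    rw [hqp', hrr] at h
    have h' : I (j + 1) ^ ((m - 1) / (q * m)) ≤
        (C * q * (1 + ((d / 2 ^ (j + 1)) ^ 2)⁻¹)) ^ (1 / q) *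
          ((I j ^ (1 / (q + 1 / 2))) ^ ((q + 1 / 2) / q)) := by
      rw [hI]; simp only; rw [hqp] at h ⊢; exact h
    have hA0 : 0 < C * q * (1 + ((d / 2 ^ (j + 1)) ^ 2)⁻¹) := by positivity
    have h2 := moser_step m q _ _ _ ((χ⁻¹) ^ (j + 1)) hm (by linarith) hA0.le (hI0 j)
      (hI0 (j + 1)) h' (by positivity)
    have e2 : (χ⁻¹) ^ (j + 1) * ((m - 1) / m) = (χ⁻¹) ^ (j + 2) := by
      rw [pow_succ _ (j + 1), hχ, inv_div]
    rw [e2] at h2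
    refine h2.trans ?_
    refine mul_le_mul_of_nonneg_right ?_ (Real.rpow_nonneg (hI0 j) _)
    have hA : C * q * (1 + ((d / 2 ^ (j + 1)) ^ 2)⁻¹) ≤ K * (4 * χ) ^ (j + 1) := by
      have hpow1 : 1 ≤ χ ^ (j + 1) := one_le_pow₀ hχ1.le
      have g1 : q ≤ (1 + m / 2) * χ ^ (j + 1) := by rw [hqdef]; nlinarith
      have g2 : 1 + ((d / 2 ^ (j + 1)) ^ 2)⁻¹ ≤ 2 / d ^ 2 * 4 ^ (j + 1) := by
        have e4 : (4 : ℝ) ^ (j + 1) = (2 ^ (j + 1)) ^ 2 := by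
          rw [← pow_mul, mul_comm, pow_mul]; norm_num
        have g3 : (1 : ℝ) ≤ 4 ^ (j + 1) := one_le_pow₀ (by norm_num)
        rw [div_pow, inv_div, ← e4]
        have g4 : 1 ≤ 4 ^ (j + 1) / d ^ 2 := by
          rw [le_div_iff₀ (by positivity)]; linarith
        have : 2 / d ^ 2 * 4 ^ (j + 1) = 2 * (4 ^ (j + 1) / d ^ 2) := by ring
        linarith
      calc C * q * (1 + ((d / 2 ^ (j + 1)) ^ 2)⁻¹)
          ≤ C * ((1 + m / 2) * χ ^ (j + 1)) * (2 / d ^ 2 * 4 ^ (j + 1)) := by gcongr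
        _ = K * (4 * χ) ^ (j + 1) := by rw [hK, mul_pow]; ring
    refine (Real.rpow_le_rpow hA0.le hA (by positivity)).trans (le_of_eq ?_)
    rw [Real.rpow_def_of_pos (by positivity), Real.log_mul (by positivity) (by positivity),
      Real.log_pow, ha]
    simp only
    push_cast
    congr 1
    ring
  have iter : ∀ j, I j ^ ((χ⁻¹) ^ (j + 1)) ≤
      Real.exp (∑ i ∈ Finset.range j, a i) * I 0 ^ (χ⁻¹) := by
    intro j
    induction j with
    | zero => simp
    | succ j ih =>
      refine (step j).trans ?_
      rw [Finset.sum_range_succ, Real.exp_add, mul_comm (Real.exp (∑ i ∈ Finset.range j, a i)),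
        mul_assoc]
      exact mul_le_mul_of_nonneg_left ih (Real.exp_pos _).le
  obtain ⟨M, hM⟩ : ∃ M : ℝ, M = Real.exp (∑' j, a j) * I 0 ^ (χ⁻¹) := ⟨_, rfl⟩
  have hM0 : 0 ≤ M := by rw [hM]; exact mul_nonneg (Real.exp_pos _).le (Real.rpow_nonneg (hI0 0) _)
  have iter2 : ∀ j, I j ≤ M ^ (χ ^ (j + 1)) := by
    intro j
    have h1 : I j ^ ((χ⁻¹) ^ (j + 1)) ≤ M := by
      refine (iter j).trans ?_
      rw [hM]
      refine mul_le_mul_of_nonneg_right ?_ (Real.rpow_nonneg (hI0 0) _)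
      exact Real.exp_le_exp.2 (hasum.sum_le_tsum _ fun i _ => ha0 i)
    have h2 := Real.rpow_le_rpow (Real.rpow_nonneg (hI0 j) _) h1
      (show 0 ≤ χ ^ (j + 1) by positivity)
    rw [← Real.rpow_mul (hI0 j), ← mul_pow, inv_mul_cancel₀ hχ0.ne', one_pow, Real.rpow_one] at h2
    exact h2
  have hae : ∀ᵐ x ∂(volume.restrict (ball x₀ R)), S x ≤ M := by
    have : IsFiniteMeasure (volume.restrict (ball x₀ R)) :=
      ⟨by rw [Measure.restrict_apply_univ]; exact measure_ball_lt_top⟩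
    have hpj : ∀ j, χ ^ (j + 1) + m / 2 = p j := fun j => by rw [hp]
    refine moser_ae_le _ S hS0 M (m / 2) hM0 (by positivity) (fun j => χ ^ (j + 1))
      (fun j => by positivity) ?_ ?_ ?_
    · exact (tendsto_pow_atTop_atTop_of_one_lt hχ1).comp (Filter.tendsto_add_atTop_nat 1)
    · intro j
      simp only [hpj]
      exact (hint (p j) (hp1 j)).mono_set (ball_subset_ball hRR₀.le)
    · intro j
      refine le_trans ?_ (iter2 j)
      simp only [hpj]
      rw [hI]
      refine setIntegral_mono_set ((hint (p j) (hp1 j)).mono_set (ball_subset_ball (hrR₀ j)))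
        (Filter.Eventually.of_forall fun x => Real.rpow_nonneg (hS0 x) _) ?_
      exact (ball_subset_ball (hrR j)).eventuallyLE
  have hfin : M = Real.exp (∑' j, a j) * ((∫ x in ball x₀ R₀,
              S x ^ (χ + (m - 1) / 2 + 1 / 2))
                ^ (1 / (χ + (m - 1) / 2 + 1 / 2))) ^ ((m + 1) / 2) := by
    have hI00 : I 0 = ∫ x in ball x₀ R₀, S x ^ (χ + (m - 1) / 2 + 1 / 2) := by
      have e1 : r 0 = R₀ := by rw [hr, hd]; simp
      have e2 : p 0 = χ + (m - 1) / 2 + 1 / 2 := by rw [hp]; simp only [zero_add, pow_one]; ring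
      rw [hI]; simp only [e1, e2]
    rw [hM, ← hI00, ← Real.rpow_mul (hI0 0)]
    congr 2
    have h3 : χ * (m - 1) = m := by rw [hχ]; field_simp
    have h4 : 0 < χ + (m - 1) / 2 + 1 / 2 := by linarith
    field_simp
    linear_combination (-1) * h3
  rw [← hfin]
  have : (ae (volume.restrict (ball x₀ R))).NeBot := by
    rw [ae_neBot, Ne, Measure.restrict_eq_zero]
    exact (measure_ball_pos _ _ hR).ne'
  refine Filter.limsup_le_of_le ?_ hae
  exact Filter.IsBoundedUnder.isCoboundedUnder_le ⟨0, by simpa using Filter.Eventually.of_forall hS0⟩
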